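/- arXiv:2407.04162 — 2 statements merged into one kernel-verified Lean document; each statement's English description precedes it below -/
import Mathlib

section
/- Let d, m be positive integers, A a real m×d matrix, y ∈ ℝ^m, z ∈ ℝ^d, x_c ∈ ℝ^d, σ_y > 0 and k > 0. Let Σ_X be a real symmetric positive definite d×d matrix. Let 0 < σ_t² < σ₁² and set σ̄_t² = σ₁² − σ_t². Define q(x₀) = k · N(x₀; z, Σ_X) · N(y; A x₀, σ_y² I), where N(u; μ, Σ) denotes the Gaussian density with mean μ and covariance Σ, define C(x₀) = (√(2π) σ₁)^d exp(‖x₀ − x_c‖²/(2σ₁²)), and define Ψ̂(x) = ∫_{ℝ^d} C(x₀) N(x; x₀, σ_t² I) q(x₀) dx₀ for x ∈ ℝ^d. Let M_t = (1 − σ_t²/σ₁²) I + σ_t² Σ_X⁻¹ + (σ_t²/σ_y²) Aᵀ A. Then M_t is positive definite, Ψ̂ is positive and differentiable, and for every x ∈ ℝ^d the gradient of log Ψ̂ at x equals −(1/σ_t²)(x − x̂(x)), where x̂(x) is the unique solution of the linear equation M_t x̂ = (x − (σ_t²/σ₁²) x_c) + σ_t² Σ_X⁻¹ z + (σ_t²/σ_y²)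 Aᵀ y. -/
open Real Matrix MeasureTheory
open scoped RealInnerProductSpace

/-- The partition function `x ↦ ∫ K exp (-(⟪u, T u⟫ - 2 ⟪u, x + b⟫ + ‖x‖² + c) / (2 s)) du` of a
coercive quadratic form is positive, and the gradient of its logarithm is `-(x - T⁻¹ (x + b)) / s`. -/
theorem gaussian_integral_pos_and_hasGradientAt_log {E : Type*} [NormedAddCommGroup E] [InnerProductSpace ℝ E]
    [FiniteDimensional ℝ E] [MeasurableSpace E] [BorelSpace E]
    (T R : E →L[ℝ] E) (hT : ∀ u v, ⟪T u, v⟫ = ⟪u, T v⟫) (hR : ∀ v, T (R v) = v)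
    {r : ℝ} (hr : 0 < r) (hTr : ∀ u, r * ‖u‖ ^ 2 ≤ ⟪u, T u⟫)
    {s : ℝ} (hs : 0 < s) {K : ℝ} (hK : 0 < K) (b : E) (c : ℝ) {Ψ : E → ℝ}
    (hΨ : ∀ x, Ψ x = ∫ u, K * Real.exp (-(1 / (2 * s)) *
      (⟪u, T u⟫ - 2 * ⟪u, x + b⟫ + ‖x‖ ^ 2 + c))) (x : E) :
    0 < Ψ x ∧ HasGradientAt (fun v => Real.log (Ψ v)) (-(1 / s) • (x - R (x + b))) x := by
  set G : ℝ := ∫ u : E, Real.exp (-(1 / (2 * s)) * ⟪u, T u⟫) with hG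
  have hint : Integrable (fun u : E => Real.exp (-(1 / (2 * s)) * ⟪u, T u⟫)) := by
    have h0 : 0 < 1 / (2 * s) * r := by positivity
    have h := (GaussianFourier.integrable_cexp_neg_mul_sq_norm_add (V := E)
      (b := ((1 / (2 * s) * r : ℝ) : ℂ)) (by simpa using h0) 0 0).norm
    refine h.mono' (by fun_prop) (ae_of_all _ fun u => ?_)
    rw [Complex.norm_exp, Real.norm_eq_abs, abs_of_pos (Real.exp_pos _)]
    apply Real.exp_le_exp.mpr
    have := mul_le_mul_of_nonneg_left (hTr u) (by positivity : 0 ≤ 1 / (2 * s))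
    have e : ((-((1 / (2 * s) * r : ℝ) : ℂ) * (‖u‖ : ℂ) ^ 2 + 0 * ((⟪(0:E), u⟫ : ℝ) : ℂ))).re
        = -(1 / (2 * s) * r) * ‖u‖ ^ 2 := by
      rw [zero_mul, add_zero]; norm_cast
    rw [e]; linarith
  have hGpos : 0 < G := integral_exp_pos hint
  have hclosed : ∀ v, Ψ v = K * G * Real.exp (-(1 / (2 * s)) *
      (‖v‖ ^ 2 + c - ⟪R (v + b), v + b⟫)) := by
    intro v
    have hshift : G = ∫ u : E, Real.exp (-(1 / (2 * s)) *
        ⟪u - R (v + b), T (u - R (v + b))⟫) :=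
      (integral_sub_right_eq_self (fun u : E => Real.exp (-(1 / (2 * s)) * ⟪u, T u⟫))
        (R (v + b))).symm
    rw [hΨ, hshift, mul_right_comm, ← integral_const_mul]
    congr 1; ext u
    rw [mul_assoc, ← Real.exp_add]
    congr 2
    have h1 : ⟪R (v + b), T u⟫ = ⟪u, v + b⟫ := by
      rw [← hT, hR, real_inner_comm]
    simp only [map_sub, inner_sub_left, inner_sub_right, hR, h1]
    ring
  have hpos : ∀ v, 0 < Ψ v := fun v => by rw [hclosed]; positivity
  refine ⟨hpos x, ?_⟩
  have hRs : ∀ u v, ⟪R u, v⟫ = ⟪u, R v⟫ := fun u v => by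
    conv_lhs => rw [← hR v]
    rw [← hT, hR]
  have hlog : (fun v => Real.log (Ψ v)) = fun v => Real.log (K * G) + -(1 / (2 * s)) *
      (‖v‖ ^ 2 + c - ⟪R (v + b), v + b⟫) := by
    ext v
    rw [hclosed, Real.log_mul (by positivity) (by positivity), Real.log_exp]
  rw [hlog, hasGradientAt_iff_hasFDerivAt]
  have hid : HasFDerivAt (fun v : E => v + b) (ContinuousLinearMap.id ℝ E) x :=
    (hasFDerivAt_id x).add_const b
  have hd := ((((hasFDerivAt_id (𝕜 := ℝ) x).norm_sq.add_const c).sub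
    ((R.hasFDerivAt.comp x hid).inner ℝ hid)).const_mul (-(1 / (2 * s)))).const_add
      (Real.log (K * G))
  refine hd.congr_fderiv ?_
  ext w
  have h2 : ⟪R w, x + b⟫ = ⟪R (x + b), w⟫ := by rw [hRs, real_inner_comm]
  simp [-map_add, h2]
  field_simp
  ring

theorem inner_toEuclideanLin_transpose {m n : Type*} [Fintype m] [Fintype n] [DecidableEq m]
    [DecidableEq n] (B : Matrix m n ℝ) (u : EuclideanSpace ℝ n) (w : EuclideanSpace ℝ m) :
    ⟪u, (Bᵀ).toEuclideanLin w⟫ = ⟪B.toEuclideanLin u, w⟫ := by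
  rw [← conjTranspose_eq_transpose_of_trivial, toEuclideanLin_conjTranspose_eq_adjoint,
    LinearMap.adjoint_inner_right]

theorem inner_toEuclideanLin_eq_dotProduct {n : Type*} [Fintype n] [DecidableEq n]
    (B : Matrix n n ℝ) (u v : EuclideanSpace ℝ n) :
    ⟪u, B.toEuclideanLin v⟫ = u.ofLp ⬝ᵥ B *ᵥ v.ofLp := by
  rw [EuclideanSpace.inner_eq_star_dotProduct, star_trivial, dotProduct_comm]
  rfl

theorem toEuclideanLin_mul_apply {l m n : Type*} [Fintype m] [Fintype n] [DecidableEq m]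
    [DecidableEq n] (B : Matrix l m ℝ) (D : Matrix m n ℝ) (u : EuclideanSpace ℝ n) :
    (B * D).toEuclideanLin u = B.toEuclideanLin (D.toEuclideanLin u) := by
  ext i
  simp [toLpLin_apply]

/-- equations (18)–(20) of the paper: under the Gaussian parameterization
`q(x₀) = k · N(x₀; z, Σ_X) · N(y; Ax₀, σ_y²I)` and with
`Ψ̂(x) = ∫ C(x₀) N(x; x₀, σ_t²I) q(x₀) dx₀`, where
`C(x₀) = (√(2π)σ₁)^d exp(‖x₀ − x_c‖²/(2σ₁²))`, the matrix
`M_t = (1 − σ_t²/σ₁²)I + σ_t²Σ_X⁻¹ + (σ_t²/σ_y²)AᵀA` is positive definite, `Ψ̂` is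
positive and (log-)differentiable, and
`∇ log Ψ̂(x) = −(1/σ_t²)(x − x̂(x))` where `x̂(x)` is the unique solution of
`M_t x̂ = (x − (σ_t²/σ₁²)x_c) + σ_t²Σ_X⁻¹z + (σ_t²/σ_y²)Aᵀy`. -/
theorem mesb_backward_drift
    (d m : ℕ) (hd : 0 < d) (hm : 0 < m)
    (A : Matrix (Fin m) (Fin d) ℝ) (y : EuclideanSpace ℝ (Fin m))
    (z xc : EuclideanSpace ℝ (Fin d))
    (σy : ℝ) (hσy : 0 < σy) (k : ℝ) (hk : 0 < k)
    (SigX : Matrix (Fin d) (Fin d) ℝ) (hSigSymm : SigX.IsSymm) (hSigPd : SigX.PosDef)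
    (σt2 σ12 : ℝ) (hσt2 : 0 < σt2) (hσlt : σt2 < σ12)
    (σbt2 : ℝ) (hσbt2 : σbt2 = σ12 - σt2)
    (q : EuclideanSpace ℝ (Fin d) → ℝ)
    (hq : ∀ x₀, q x₀ =
      k * ((2 * π) ^ (-(d:ℝ)/2) * SigX.det ^ (-(1:ℝ)/2)
            * Real.exp (-(1/2) * ((x₀ - z) ⬝ᵥ (SigX⁻¹).mulVec (x₀ - z))))
        * ((2 * π * σy^2) ^ (-(m:ℝ)/2)
            * Real.exp (-‖A.toEuclideanLin x₀ - y‖^2 / (2 * σy^2))))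
    (C : EuclideanSpace ℝ (Fin d) → ℝ)
    (hC : ∀ x₀, C x₀ =
      (Real.sqrt (2 * π) * Real.sqrt σ12)^d * Real.exp (‖x₀ - xc‖^2 / (2 * σ12)))
    (Ψ : EuclideanSpace ℝ (Fin d) → ℝ)
    (hΨ : ∀ x, Ψ x =
      ∫ x₀ : EuclideanSpace ℝ (Fin d),
        C x₀ * ((2 * π * σt2) ^ (-(d:ℝ)/2) * Real.exp (-‖x - x₀‖^2 / (2 * σt2))) * q x₀)
    (Mt : Matrix (Fin d) (Fin d) ℝ)
    (hMt : Mt = (1 - σt2/σ12) • (1 : Matrix (Fin d) (Fin d) ℝ)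
        + σt2 • SigX⁻¹ + (σt2/σy^2) • (Aᵀ * A)) :
    Mt.PosDef ∧ (∀ x, 0 < Ψ x)
    ∧ (∀ x, DifferentiableAt ℝ (fun u => Real.log (Ψ u)) x)
    ∧ ∀ x : EuclideanSpace ℝ (Fin d),
        (∃! xh : EuclideanSpace ℝ (Fin d),
          Mt.toEuclideanLin xh
            = (x - (σt2/σ12) • xc) + σt2 • (SigX⁻¹).toEuclideanLin z
              + (σt2/σy^2) • (Aᵀ).toEuclideanLin y)
        ∧ ∀ xh : EuclideanSpace ℝ (Fin d),
          Mt.toEuclideanLin xh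
            = (x - (σt2/σ12) • xc) + σt2 • (SigX⁻¹).toEuclideanLin z
              + (σt2/σy^2) • (Aᵀ).toEuclideanLin y →
          gradient (fun u => Real.log (Ψ u)) x = (-(1/σt2)) • (x - xh) := by
  have hσ12 : 0 < σ12 := hσt2.trans hσlt
  have hr : 0 < 1 - σt2 / σ12 := sub_pos.mpr ((div_lt_one hσ12).mpr hσlt)
  have hSpd : SigX⁻¹.PosDef := hSigPd.inv
  have hMpd : Mt.PosDef := by
    rw [hMt, ← conjTranspose_eq_transpose_of_trivial A]
    exact ((PosDef.one.smul hr).add (hSpd.smul hσt2)).add_posSemidef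
      ((posSemidef_conjTranspose_mul_self A).smul (by positivity : 0 ≤ σt2 / σy ^ 2))
  have hMdet : IsUnit Mt.det := (isUnit_iff_isUnit_det _).mp hMpd.isUnit
  have hSsymm : (SigX⁻¹)ᵀ = SigX⁻¹ := by rw [transpose_nonsing_inv, hSigSymm.eq]
  have hMsymm : Mtᵀ = Mt := by
    rw [← conjTranspose_eq_transpose_of_trivial]; exact hMpd.isHermitian
  have hSinner : ∀ u v : EuclideanSpace ℝ (Fin d),
      ⟪u, (SigX⁻¹).toEuclideanLin v⟫ = ⟪(SigX⁻¹).toEuclideanLin u, v⟫ := fun u v => by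
    rw [← inner_toEuclideanLin_transpose, hSsymm]
  have hTR : ∀ v : EuclideanSpace ℝ (Fin d),
      Mt.toEuclideanLin ((Mt⁻¹).toEuclideanLin v) = v := fun v => by
    rw [← toEuclideanLin_mul_apply, mul_nonsing_inv _ hMdet]
    simp
  have hRT : ∀ v : EuclideanSpace ℝ (Fin d),
      (Mt⁻¹).toEuclideanLin (Mt.toEuclideanLin v) = v := fun v => by
    rw [← toEuclideanLin_mul_apply, nonsing_inv_mul _ hMdet]
    simp
  have hTapply : ∀ u : EuclideanSpace ℝ (Fin d), Mt.toEuclideanLin u =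
      (1 - σt2 / σ12) • u + σt2 • (SigX⁻¹).toEuclideanLin u
        + (σt2 / σy ^ 2) • (Aᵀ).toEuclideanLin (A.toEuclideanLin u) := fun u => by
    rw [← toEuclideanLin_mul_apply, hMt]
    simp
  have hquad : ∀ u : EuclideanSpace ℝ (Fin d), ⟪u, Mt.toEuclideanLin u⟫ =
      (1 - σt2 / σ12) * ‖u‖ ^ 2 + σt2 * ⟪u, (SigX⁻¹).toEuclideanLin u⟫
        + σt2 / σy ^ 2 * ‖A.toEuclideanLin u‖ ^ 2 := fun u => by
    rw [hTapply]
    simp only [inner_add_right, inner_smul_right, inner_toEuclideanLin_transpose,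
      real_inner_self_eq_norm_sq]
  have hcoer : ∀ u : EuclideanSpace ℝ (Fin d),
      (1 - σt2 / σ12) * ‖u‖ ^ 2 ≤ ⟪u, Mt.toEuclideanLin u⟫ := fun u => by
    have h1 : 0 ≤ ⟪u, (SigX⁻¹).toEuclideanLin u⟫ := by
      rw [inner_toEuclideanLin_eq_dotProduct]
      simpa using hSpd.posSemidef.dotProduct_mulVec_nonneg u.ofLp
    rw [hquad, add_assoc]
    exact le_add_of_nonneg_right (by positivity)
  set b : EuclideanSpace ℝ (Fin d) := -((σt2 / σ12) • xc) + σt2 • (SigX⁻¹).toEuclideanLin z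
    + (σt2 / σy ^ 2) • (Aᵀ).toEuclideanLin y with hb
  have hrhs : ∀ x, (x - (σt2 / σ12) • xc) + σt2 • (SigX⁻¹).toEuclideanLin z
      + (σt2 / σy ^ 2) • (Aᵀ).toEuclideanLin y = x + b := fun x => by
    rw [hb]; abel
  have hdet : 0 < SigX.det := hSigPd.det_pos
  have key := gaussian_integral_pos_and_hasGradientAt_log
    (Mt.toEuclideanLin.toContinuousLinearMap) ((Mt⁻¹).toEuclideanLin.toContinuousLinearMap)
    (fun u v => by
      simp only [LinearMap.coe_toContinuousLinearMap']
      rw [← inner_toEuclideanLin_transpose, hMsymm])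
    hTR hr hcoer hσt2
    (K := (√(2 * π) * √σ12) ^ d * (2 * π * σt2) ^ (-(d : ℝ) / 2) *
      (k * ((2 * π) ^ (-(d : ℝ) / 2) * SigX.det ^ (-(1 : ℝ) / 2)) *
        (2 * π * σy ^ 2) ^ (-(m : ℝ) / 2)))
    (by positivity) b
    (-(σt2 / σ12) * ‖xc‖ ^ 2 + σt2 * ⟪z, (SigX⁻¹).toEuclideanLin z⟫ + σt2 / σy ^ 2 * ‖y‖ ^ 2)
    (Ψ := Ψ) (fun x => by
      rw [hΨ]
      congr 1; ext u
      have hexp : -(1 / (2 * σt2)) * (⟪u, Mt.toEuclideanLin u⟫ - 2 * ⟪u, x + b⟫ + ‖x‖ ^ 2 +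
          (-(σt2 / σ12) * ‖xc‖ ^ 2 + σt2 * ⟪z, (SigX⁻¹).toEuclideanLin z⟫
            + σt2 / σy ^ 2 * ‖y‖ ^ 2)) =
          ‖u - xc‖ ^ 2 / (2 * σ12) + -‖x - u‖ ^ 2 / (2 * σt2)
            + -(1 / 2) * ⟪u - z, (SigX⁻¹).toEuclideanLin (u - z)⟫
            + -‖A.toEuclideanLin u - y‖ ^ 2 / (2 * σy ^ 2) := by
        have h1 : ⟪z, (SigX⁻¹).toEuclideanLin u⟫ = ⟪u, (SigX⁻¹).toEuclideanLin z⟫ := by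
          rw [hSinner, real_inner_comm]
        rw [hquad, hb]
        simp only [norm_sub_sq_real, map_sub, inner_sub_left, inner_sub_right, inner_add_right,
          inner_neg_right, inner_smul_right, inner_toEuclideanLin_transpose, h1,
          real_inner_comm u x]
        field_simp
        ring
      simp only [LinearMap.coe_toContinuousLinearMap']
      rw [hexp, hC, hq, Real.exp_add, Real.exp_add, Real.exp_add,
        inner_toEuclideanLin_eq_dotProduct]
      simp only [WithLp.ofLp_sub]
      ring)
  refine ⟨hMpd, fun x => (key x).1, fun x => (key x).2.differentiableAt, fun x => ⟨?_, ?_⟩⟩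
  · refine ⟨(Mt⁻¹).toEuclideanLin (x + b), ?_, fun v hv => ?_⟩
    · simp only [hrhs, hTR]
    · rw [← hRT v, hv, hrhs]
  · intro xh hxh
    rw [(key x).2.gradient]
    rw [hrhs] at hxh
    simp only [LinearMap.coe_toContinuousLinearMap']
    rw [← hxh, hRT]
end

section
/- Let d, p, m be positive integers, σ_t > 0, σ > 0, A a real m×p matrix, y ∈ ℝ^m, and h : ℝ^d → ℝ^p differentiable. Let g : ℝ^d → ℝ be positive and such that log g is differentiable with ∇ log g (x) = −(1/σ_t²)(x − h(x)) for all x (here p = d for this term to make sense, so take p = d). Define r(x) = (2π σ²)^{−m/2} exp(−‖A h(x) − y‖²/(2σ²)) and Ψ̂ = g · r. Then log Ψ̂ is differentiable and for every x ∈ ℝ^d, ∇ log Ψ̂ (x) = −(1/σ_t²)(x − X̂^{deep}(x)), where X̂^{deep}(x) = h(x) − α ∇_x ‖A h(x) − y‖₂² and α = σ_t²/(2σ²). -/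
open Real Matrix

/-- algebraic core of Theorem 3 of the paper: if `g > 0` with
`∇ log g(x) = −(1/σ_t²)(x − h(x))` and
`r(x) = (2πσ²)^{-m/2} exp(−‖Ah(x) − y‖²/(2σ²))`, then `Ψ̂ = g·r` satisfies
`∇ log Ψ̂(x) = −(1/σ_t²)(x − X̂^{deep}(x))` with
`X̂^{deep}(x) = h(x) − α ∇_x‖Ah(x) − y‖²` and `α = σ_t²/(2σ²)`. -/
theorem cddb_deep_drift
    (d m : ℕ) (hd : 0 < d) (hm : 0 < m)
    (σt σ : ℝ) (hσt : 0 < σt) (hσ : 0 < σ)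
    (A : Matrix (Fin m) (Fin d) ℝ) (y : EuclideanSpace ℝ (Fin m))
    (h : EuclideanSpace ℝ (Fin d) → EuclideanSpace ℝ (Fin d))
    (hh : Differentiable ℝ h)
    (g : EuclideanSpace ℝ (Fin d) → ℝ) (hgpos : ∀ x, 0 < g x)
    (hglog : Differentiable ℝ (fun x => Real.log (g x)))
    (hggrad : ∀ x, gradient (fun u => Real.log (g u)) x = (-(1/σt^2)) • (x - h x))
    (r : EuclideanSpace ℝ (Fin d) → ℝ)
    (hr : ∀ x, r x = (2 * π * σ^2) ^ (-(m:ℝ)/2)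
        * Real.exp (-‖A.toEuclideanLin (h x) - y‖^2 / (2 * σ^2)))
    (Ψ : EuclideanSpace ℝ (Fin d) → ℝ) (hΨ : ∀ x, Ψ x = g x * r x)
    (α : ℝ) (hα : α = σt^2 / (2 * σ^2))
    (Xdeep : EuclideanSpace ℝ (Fin d) → EuclideanSpace ℝ (Fin d))
    (hXdeep : ∀ x, Xdeep x
      = h x - α • gradient (fun u => ‖A.toEuclideanLin (h u) - y‖^2) x) :
    Differentiable ℝ (fun x => Real.log (Ψ x))
    ∧ ∀ x : EuclideanSpace ℝ (Fin d),
        gradient (fun u => Real.log (Ψ u)) x = (-(1/σt^2)) • (x - Xdeep x) := by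
  have hN : Differentiable ℝ fun u => ‖A.toEuclideanLin (h u) - y‖ ^ 2 :=
    ((A.toEuclideanLin.toContinuousLinearMap.differentiable.comp hh).sub_const y).norm_sq ℝ
  have hlog : (fun x => Real.log (Ψ x)) = fun x => Real.log (g x) +
      (Real.log ((2 * π * σ ^ 2) ^ (-(m : ℝ) / 2))
        - 1 / (2 * σ ^ 2) * ‖A.toEuclideanLin (h x) - y‖ ^ 2) := by
    funext x
    have hc : (0 : ℝ) < (2 * π * σ ^ 2) ^ (-(m : ℝ) / 2) := by positivity
    rw [hΨ, hr, Real.log_mul (hgpos x).ne' (by positivity),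
      Real.log_mul hc.ne' (Real.exp_ne_zero _), Real.log_exp]
    ring
  have hd' := (hN.const_mul (1 / (2 * σ ^ 2))).const_sub
    (Real.log ((2 * π * σ ^ 2) ^ (-(m : ℝ) / 2)))
  rw [hlog]
  refine ⟨hglog.add hd', fun x => ?_⟩
  have hgrad := hggrad x
  rw [hXdeep, hα]
  unfold gradient at hgrad ⊢
  rw [fderiv_fun_add (hglog x) (hd' x), fderiv_const_sub, fderiv_const_mul (hN x), map_add, hgrad,
    map_neg, map_smul]
  have hcoef : 1 / (2 * σ ^ 2) = 1 / σt ^ 2 * (σt ^ 2 / (2 * σ ^ 2)) := by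
    field_simp
  rw [hcoef]
  module
end
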